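/- arXiv:1801.05015 — 2 statements merged into one kernel-verified Lean document; each statement's English description precedes it below -/
import Mathlib

section
/- For any information states I and J: I → J if and only if |I| ≤ |J| (the cardinality of I is at most that of J). -/
structure EidoSys where
  State : Type
  [decEq : DecidableEq State]
  Eido : Set (Finset State)
  pair : State → State → State
  Sim : Finset State → Finset State → Prop
  Arrow : Finset State → Finset State → Prop
  pair_inj : ∀ a b a' b', pair a b = pair a' b' → a = a' ∧ b = b'
  eido_nonempty : ∀ A ∈ Eido, A.Nonempty
  singleton_mem : ∀ a : State, ({a} : Finset State) ∈ Eido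
  comb_mem : ∀ A B : Finset State, Finset.image₂ pair A B ∈ Eido ↔ A ∈ Eido ∧ B ∈ Eido
  subset_mem : ∀ A B : Finset State, A ∈ Eido → B ⊆ A → B.Nonempty → B ∈ Eido
  sim_refl : ∀ A : Finset State, Sim A A
  sim_symm : ∀ A B : Finset State, Sim A B → Sim B A
  sim_trans : ∀ A B C : Finset State, Sim A B → Sim B C → Sim A C
  sim_comm : ∀ A B : Finset State, Sim (Finset.image₂ pair A B) (Finset.image₂ pair B A)
  sim_assoc : ∀ A B C : Finset State,
    Sim (Finset.image₂ pair (Finset.image₂ pair A B) C) (Finset.image₂ pair A (Finset.image₂ pair B C))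
  sim_congr : ∀ A B C : Finset State, Sim A B → Sim (Finset.image₂ pair A C) (Finset.image₂ pair B C)
  arrow_of_sim : ∀ A B : Finset State, A ∈ Eido → B ∈ Eido → Sim A B → Arrow A B
  arrow_trans : ∀ A B C : Finset State, Arrow A B → Arrow B C → Arrow A C
  arrow_comb : ∀ A B C : Finset State, Arrow A B → Arrow (Finset.image₂ pair A C) (Finset.image₂ pair B C)
  arrow_cancel : ∀ (A B : Finset State) (s : State),
    Arrow (Finset.image₂ pair A {s}) (Finset.image₂ pair B {s}) → Arrow A B
  arrow_nsubset : ∀ A B : Finset State, A ∈ Eido → B ∈ Eido → B ⊂ A → ¬ Arrow A B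
  arrow_subset_single : ∀ (A A' : Finset State) (b : State),
    A ∈ Eido → A' ⊆ A → A'.Nonempty → Arrow A {b} → Arrow A' {b}
  arrow_union : ∀ A₁ A₂ B₁ B₂ : Finset State,
    A₁ ∈ Eido → A₂ ∈ Eido → B₁ ∈ Eido → B₂ ∈ Eido →
    Disjoint A₁ A₂ → Disjoint B₁ B₂ →
    (∀ a ∈ A₁ ∪ A₂, ∀ b ∈ A₁ ∪ A₂, Arrow {a} {b} ∨ Arrow {b} {a}) →
    (∀ a ∈ B₁ ∪ B₂, ∀ b ∈ B₁ ∪ B₂, Arrow {a} {b} ∨ Arrow {b} {a}) →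
    Arrow A₁ B₁ → Arrow A₂ B₂ → Arrow (A₁ ∪ A₂) (B₁ ∪ B₂)

attribute [instance] EidoSys.decEq

namespace EidoSys

variable (S : EidoSys)

/-- Combination of eidostates: the Cartesian product, realized via the pairing map. -/
def comb (A B : Finset S.State) : Finset S.State := Finset.image₂ S.pair A B

/-- The process (A,B) is possible: A ⇌ B. -/
def Pos (A B : Finset S.State) : Prop := S.Arrow A B ∨ S.Arrow B A

/-- A ↔ B. -/
def Rev (A B : Finset S.State) : Prop := S.Arrow A B ∧ S.Arrow B A

/-- Uniform eidostate. -/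
def Uniform (A : Finset S.State) : Prop := A ∈ S.Eido ∧ ∀ a ∈ A, ∀ b ∈ A, S.Pos {a} {b}

/-- Record state: a ↔ a + r for some state a. -/
def IsRecord (r : S.State) : Prop := ∃ a : S.State, S.Rev {a} (S.comb {a} {r})

/-- Information state: an eidostate all of whose elements are record states. -/
def IsInfo (I : Finset S.State) : Prop := I ∈ S.Eido ∧ ∀ r ∈ I, S.IsRecord r

/-- Bit state: an information state with exactly two elements. -/
def IsBit (I : Finset S.State) : Prop := S.IsInfo I ∧ I.card = 2

/-- Information axiom: there exist a bit state and a possible bit process. -/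
def InfoAxiom : Prop := ∃ (r : S.State) (I : Finset S.State), S.IsRecord r ∧ S.IsBit I ∧ S.Pos {r} I

/-- Demon axiom. -/
def DemonAxiom : Prop := ∀ a b : S.State, ∀ J : Finset S.State, S.IsInfo J →
    S.Arrow {a} (S.comb {b} J) →
    (∃ I : Finset S.State, S.IsInfo I ∧ S.Arrow {b} (S.comb {a} I)) ∧
    (∀ I : Finset S.State, S.IsInfo I → S.Arrow {a} (S.comb {b} I) ∨ S.Arrow (S.comb {b} I) {a})

/-- `copies A n` is the combination of `n+1` copies of `A` (so `copies A 0 = A`). -/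
def copies (A : Finset S.State) : ℕ → Finset S.State
  | 0 => A
  | n + 1 => S.comb A (copies A n)

/-- Stability axiom: if nA → nB + J for arbitrarily large n, then A → B. -/
def StabilityAxiom : Prop := ∀ A B J : Finset S.State, A ∈ S.Eido → B ∈ S.Eido → S.IsInfo J →
    (∀ N : ℕ, ∃ n ≥ N, S.Arrow (S.copies A n) (S.comb (S.copies B n) J)) → S.Arrow A B

/-- State-equivalence axiom. -/
def StateEquivAxiom : Prop := ∀ E : Finset S.State, S.Uniform E →
    ∃ e x y : S.State, S.Arrow {x} {y} ∧ S.Rev (S.comb E {x}) (S.comb {e} {y})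

/-- `addCopies A B k` is A + k·B (k copies of B appended to A). -/
def addCopies (A B : Finset S.State) : ℕ → Finset S.State
  | 0 => A
  | k + 1 => S.comb (addCopies A B k) B

/-- A designated set of mechanical states. -/
def MechSet (M : Set S.State) : Prop :=
  (∀ l ∈ M, ∀ m ∈ M, S.pair l m ∈ M) ∧
  (∀ l ∈ M, ∀ m ∈ M, S.Arrow {l} {m} → S.Arrow {m} {l})

/-- Component of content on uniform eidostates. -/
def IsCoCU (Q : Finset S.State → ℝ) : Prop :=
  (∀ E F : Finset S.State, S.Uniform E → S.Uniform F → Q (S.comb E F) = Q E + Q F) ∧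
  (∀ E F : Finset S.State, S.Uniform E → S.Uniform F → S.Pos E F → Q E = Q F)

/-- Entropy function on the uniform eidostates (relative to mechanical states M). -/
def IsEntropyU (M : Set S.State) (Ent : Finset S.State → ℝ) : Prop :=
  (∀ E F : Finset S.State, S.Uniform E → S.Uniform F → Ent (S.comb E F) = Ent E + Ent F) ∧
  (∀ E F : Finset S.State, S.Uniform E → S.Uniform F → S.Pos E F → (S.Arrow E F ↔ Ent E ≤ Ent F)) ∧
  (∀ m ∈ M, Ent {m} = 0) ∧
  (∀ I : Finset S.State, S.IsInfo I → Ent I = Real.logb 2 (I.card))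

end EidoSys

namespace EidoSys

variable {S : EidoSys}

lemma comb_singleton (a b : S.State) : S.comb {a} {b} = {S.pair a b} :=
  Finset.image₂_singleton

lemma comb_mem_eido {A B : Finset S.State} (hA : A ∈ S.Eido) (hB : B ∈ S.Eido) :
    S.comb A B ∈ S.Eido :=
  (S.comb_mem A B).2 ⟨hA, hB⟩

lemma arrow_comb_comm {A B : Finset S.State} (hA : A ∈ S.Eido) (hB : B ∈ S.Eido) :
    S.Arrow (S.comb A B) (S.comb B A) :=
  S.arrow_of_sim _ _ (comb_mem_eido hA hB) (comb_mem_eido hB hA) (S.sim_comm A B)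

lemma arrow_comb_assoc {A B C : Finset S.State} (hA : A ∈ S.Eido) (hB : B ∈ S.Eido)
    (hC : C ∈ S.Eido) : S.Arrow (S.comb (S.comb A B) C) (S.comb A (S.comb B C)) :=
  S.arrow_of_sim _ _ (comb_mem_eido (comb_mem_eido hA hB) hC)
    (comb_mem_eido hA (comb_mem_eido hB hC)) (S.sim_assoc A B C)

lemma arrow_comb_assoc_symm {A B C : Finset S.State} (hA : A ∈ S.Eido) (hB : B ∈ S.Eido)
    (hC : C ∈ S.Eido) : S.Arrow (S.comb A (S.comb B C)) (S.comb (S.comb A B) C) :=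
  S.arrow_of_sim _ _ (comb_mem_eido hA (comb_mem_eido hB hC))
    (comb_mem_eido (comb_mem_eido hA hB) hC) (S.sim_symm _ _ (S.sim_assoc A B C))

/-- Any record state can be turned into any other one. -/
lemma IsRecord.arrow {r s : S.State} (hr : S.IsRecord r) (hs : S.IsRecord s) :
    S.Arrow {r} {s} := by
  obtain ⟨a, -, ha⟩ := hr
  obtain ⟨b, hb, -⟩ := hs
  have e := S.singleton_mem
  have absorb : S.Arrow (S.comb {r} (S.comb {a} {b})) (S.comb {a} {b}) :=
    S.arrow_trans _ _ _ (arrow_comb_assoc_symm (e r) (e a) (e b))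
      (S.arrow_comb _ _ {b} (S.arrow_trans _ _ _ (arrow_comb_comm (e r) (e a)) ha))
  have emit : S.Arrow (S.comb {a} {b}) (S.comb {s} (S.comb {a} {b})) :=
    S.arrow_trans _ _ _ (arrow_comb_comm (e a) (e b)) <|
    S.arrow_trans _ _ _ (S.arrow_comb _ _ {a} hb) <|
    S.arrow_trans _ _ _ (S.arrow_comb _ _ {a} (arrow_comb_comm (e b) (e s))) <|
    S.arrow_trans _ _ _ (arrow_comb_assoc (e s) (e b) (e a)) <|
    S.arrow_trans _ _ _ (arrow_comb_comm (e s) (comb_mem_eido (e b) (e a))) <|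
    S.arrow_trans _ _ _ (S.arrow_comb _ _ {s} (arrow_comb_comm (e b) (e a))) <|
    arrow_comb_comm (comb_mem_eido (e a) (e b)) (e s)
  have h := S.arrow_trans _ _ _ absorb emit
  rw [comb_singleton a b] at h
  exact S.arrow_cancel _ _ _ h

lemma IsInfo.nonempty {I : Finset S.State} (hI : S.IsInfo I) : I.Nonempty :=
  S.eido_nonempty I hI.1

lemma IsInfo.mono {I I' : Finset S.State} (hI : S.IsInfo I) (hsub : I' ⊆ I)
    (hne : I'.Nonempty) : S.IsInfo I' :=
  ⟨S.subset_mem I I' hI.1 hsub hne, fun r hr => hI.2 r (hsub hr)⟩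

/-- A process between information states extends to one with a record state adjoined on each side. -/
lemma arrow_insert {x y : S.State} {I J : Finset S.State} (hxI : S.IsInfo (insert x I))
    (hyJ : S.IsInfo (insert y J)) (hx : x ∉ I) (hy : y ∉ J) (hI : I.Nonempty) (hJ : J.Nonempty)
    (h : S.Arrow I J) : S.Arrow (insert x I) (insert y J) := by
  have hrx := hxI.2 x (Finset.mem_insert_self x I)
  have hry := hyJ.2 y (Finset.mem_insert_self y J)
  rw [Finset.insert_eq] at hxI hyJ ⊢
  rw [Finset.insert_eq]
  exact S.arrow_union _ _ _ _ (S.singleton_mem x)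
    (hxI.mono Finset.subset_union_right hI).1 (S.singleton_mem y)
    (hyJ.mono Finset.subset_union_right hJ).1
    (Finset.disjoint_singleton_left.2 hx) (Finset.disjoint_singleton_left.2 hy)
    (fun a ha b hb => .inl ((hxI.2 a ha).arrow (hxI.2 b hb)))
    (fun a ha b hb => .inl ((hyJ.2 a ha).arrow (hyJ.2 b hb)))
    (hrx.arrow hry) h

/-- If record states can be expanded into information states with at most `k + 1` elements, then
every information state can be turned into those with up to `k` more elements. -/
lemma arrow_of_card_le_add {k : ℕ}
    (h : ∀ x J, S.IsRecord x → S.IsInfo J → J.card ≤ k + 1 → S.Arrow {x} J)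
    {I J : Finset S.State} (hI : S.IsInfo I) (hJ : S.IsInfo J) (hIJ : I.card ≤ J.card)
    (hJI : J.card ≤ I.card + k) : S.Arrow I J := by
  induction hI.nonempty using Finset.Nonempty.cons_induction generalizing J with
  | singleton x =>
    exact h x J (hI.2 x (Finset.mem_singleton_self x)) hJ (by simpa [add_comm] using hJI)
  | cons x I' hx hne ih =>
    obtain ⟨y, hy⟩ := hJ.nonempty
    rw [Finset.cons_eq_insert] at hI ⊢
    rw [Finset.card_cons] at hIJ hJI
    have hcard := Finset.card_erase_add_one hy
    have hpos := hne.card_pos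
    have hne' : (J.erase y).Nonempty := Finset.card_pos.1 (by omega)
    have hins := Finset.insert_erase hy
    have hstep := ih (hI.mono (Finset.subset_insert x I') hne)
      (hJ.mono (Finset.erase_subset y J) hne') (by omega) (by omega)
    rw [← hins]
    exact arrow_insert hI (by rwa [hins]) hx (Finset.notMem_erase y J) hne hne' hstep

lemma arrow_of_card_eq {I J : Finset S.State} (hI : S.IsInfo I) (hJ : S.IsInfo J)
    (hIJ : I.card = J.card) : S.Arrow I J := by
  refine arrow_of_card_le_add (k := 0) (fun x K hx hK hcard => ?_) hI hJ hIJ.le hIJ.ge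
  obtain ⟨y, rfl⟩ := Finset.card_eq_one.1 (le_antisymm hcard hK.nonempty.card_pos)
  exact hx.arrow (hK.2 y (Finset.mem_singleton_self y))

lemma card_le_of_arrow {I J : Finset S.State} (hI : S.IsInfo I) (hJ : S.IsInfo J)
    (h : S.Arrow I J) : I.card ≤ J.card := by
  by_contra! hlt
  obtain ⟨K, hKI, hK⟩ := Finset.exists_subset_card_eq hlt.le
  have hKinfo := hI.mono hKI (Finset.card_pos.1 (hK ▸ hJ.nonempty.card_pos))
  have hne : K ≠ I := by rintro rfl; omega
  exact S.arrow_nsubset I K hI.1 hKinfo.1 (Finset.ssubset_iff_subset_ne.2 ⟨hKI, hne⟩)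
    (S.arrow_trans _ _ _ h (arrow_of_card_eq hJ hKinfo hK.symm))

lemma IsRecord.isInfo {r : S.State} (hr : S.IsRecord r) : S.IsInfo {r} :=
  ⟨S.singleton_mem r, by simpa using hr⟩

lemma InfoAxiom.arrow_bit (hinfo : S.InfoAxiom) {x : S.State} {J : Finset S.State}
    (hx : S.IsRecord x) (hJ : S.IsBit J) : S.Arrow {x} J := by
  obtain ⟨r, I, hr, hI, hrI | hIr⟩ := hinfo
  · exact S.arrow_trans _ _ _ (hx.arrow hr) <|
      S.arrow_trans _ _ _ hrI (arrow_of_card_eq hI.1 hJ.1 (hI.2.trans hJ.2.symm))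
  · have := card_le_of_arrow hI.1 hr.isInfo hIr
    rw [hI.2, Finset.card_singleton] at this
    omega

lemma InfoAxiom.arrow_singleton (hinfo : S.InfoAxiom) {x : S.State} {J : Finset S.State}
    (hx : S.IsRecord x) (hJ : S.IsInfo J) : S.Arrow {x} J := by
  induction hJ.nonempty using Finset.Nonempty.cons_induction generalizing x with
  | singleton y => exact hx.arrow (hJ.2 y (Finset.mem_singleton_self y))
  | cons y J' hy hne ih =>
    rw [Finset.cons_eq_insert] at hJ ⊢
    obtain ⟨z, hz⟩ := hne
    have hyz : y ∉ ({z} : Finset S.State) := by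
      rw [Finset.mem_singleton]
      rintro rfl
      exact hy hz
    have hbit : S.IsBit {y, z} :=
      ⟨hJ.mono (Finset.insert_subset_insert y (Finset.singleton_subset_iff.2 hz))
        (Finset.insert_nonempty y {z}), Finset.card_pair (by simpa using hyz)⟩
    exact S.arrow_trans _ _ _ (hinfo.arrow_bit hx hbit) <|
      arrow_insert hbit.1 hJ hyz hy (Finset.singleton_nonempty z) ⟨z, hz⟩
        (ih (hJ.2 z (Finset.mem_insert_of_mem hz))
          (hJ.mono (Finset.subset_insert y J') ⟨z, hz⟩))

end EidoSys

/-- For information states I and J, I → J iff |I| ≤ |J|. -/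
theorem stmt3 (S : EidoSys) (hinfo : S.InfoAxiom) :
    ∀ I J : Finset S.State, S.IsInfo I → S.IsInfo J →
      (S.Arrow I J ↔ I.card ≤ J.card) :=
  fun _ J hI hJ => ⟨EidoSys.card_le_of_arrow hI hJ, fun h =>
    EidoSys.arrow_of_card_le_add (k := J.card)
      (fun _ _ hx hK _ => hinfo.arrow_singleton hx hK) hI hJ h (Nat.le_add_left _ _)⟩
end

section
/- A singleton process is demonically possible if and only if it is possible: for states a and b, there exists an information state J with a → b + J or b → a + J if and only if a ⇌ b. -/
namespace EidoSys

/-- A record state can be appended to or deleted from any state reversibly. -/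
theorem IsRecord.rev_comb {S : EidoSys} {r : S.State} (hr : S.IsRecord r) (b : S.State) :
    S.Rev {b} (S.comb {b} {r}) := by
  obtain ⟨c, hc, hc'⟩ := hr
  have hsim : S.Sim (S.comb (S.comb {b} {r}) {c}) (S.comb (S.comb {c} {r}) {b}) :=
    S.sim_trans _ _ _ (S.sim_assoc _ _ _)
      (S.sim_trans _ _ _ (S.sim_comm _ _) (S.sim_congr _ _ _ (S.sim_comm _ _)))
  have mem₂ (x y : S.State) : S.comb {x} {y} ∈ S.Eido :=
    (S.comb_mem _ _).2 ⟨S.singleton_mem x, S.singleton_mem y⟩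
  have mem₃ (x y z : S.State) : S.comb (S.comb {x} {y}) {z} ∈ S.Eido :=
    (S.comb_mem _ _).2 ⟨mem₂ x y, S.singleton_mem z⟩
  constructor <;> apply S.arrow_cancel _ _ c
  · exact S.arrow_trans _ _ _ (S.arrow_of_sim _ _ (mem₂ b c) (mem₂ c b) (S.sim_comm _ _))
      (S.arrow_trans _ _ _ (S.arrow_comb _ _ {b} hc)
        (S.arrow_of_sim _ _ (mem₃ c r b) (mem₃ b r c) (S.sim_symm _ _ hsim)))
  · exact S.arrow_trans _ _ _ (S.arrow_of_sim _ _ (mem₃ b r c) (mem₃ c r b) hsim)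
      (S.arrow_trans _ _ _ (S.arrow_comb _ _ {b} hc')
        (S.arrow_of_sim _ _ (mem₂ c b) (mem₂ b c) (S.sim_comm _ _)))

theorem IsRecord.isInfo_singleton {S : EidoSys} {r : S.State} (hr : S.IsRecord r) :
    S.IsInfo {r} :=
  ⟨S.singleton_mem r, fun s hs => by rwa [Finset.mem_singleton.1 hs]⟩

/-- Under the demon axiom, a process producing an information state as a by-product is possible
without it. -/
theorem DemonAxiom.pos_of_arrow_comb {S : EidoSys} (hdemon : S.DemonAxiom) {r : S.State}
    (hr : S.IsRecord r) {a b : S.State} {J : Finset S.State} (hJ : S.IsInfo J)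
    (h : S.Arrow {a} (S.comb {b} J)) : S.Pos {a} {b} :=
  ((hdemon a b J hJ h).2 {r} hr.isInfo_singleton).imp
    (fun h => S.arrow_trans _ _ _ h (hr.rev_comb b).2)
    (fun h => S.arrow_trans _ _ _ (hr.rev_comb b).1 h)

end EidoSys

/-- A singleton process is demonically possible iff it is possible: there is an
information state J with a → b + J or b → a + J iff a ⇌ b. -/
theorem stmt7 (S : EidoSys) (hinfo : S.InfoAxiom) (hdemon : S.DemonAxiom) :
    ∀ a b : S.State,
      (∃ J : Finset S.State, S.IsInfo J ∧
        (S.Arrow {a} (S.comb {b} J) ∨ S.Arrow {b} (S.comb {a} J))) ↔ S.Pos {a} {b} := by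
  intro a b
  obtain ⟨r, -, hr, -⟩ := hinfo
  constructor
  · rintro ⟨J, hJ, h | h⟩
    · exact hdemon.pos_of_arrow_comb hr hJ h
    · exact (hdemon.pos_of_arrow_comb hr hJ h).symm
  · intro h
    exact ⟨{r}, hr.isInfo_singleton, h.imp
      (fun h => S.arrow_trans _ _ _ h (hr.rev_comb b).1)
      (fun h => S.arrow_trans _ _ _ h (hr.rev_comb a).1)⟩
end
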